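/- arXiv:2001.00536 — 2 statements merged into one kernel-verified Lean document; each statement's English description precedes it below -/
import Mathlib

section
/- Let n ≥ 1 and let a_1, …, a_n be integers with a_i ≥ 2, and let w = x_1^{a_1} + Σ_{i=2}^{n} x_{i−1} x_i^{a_i} ∈ ℂ[x_1, …, x_n]. Let 𝔅 ⊂ ℕ^n be the disjoint union over 0 ≤ k ≤ ⌊n/2⌋ of the sets 𝔅^k consisting of all m ∈ ℕ^n such that m_{n−2i} = a_{n−2i} − 1 and m_{n−2i−1} = 0 for 0 ≤ i ≤ k−1, and 0 ≤ m_j ≤ a_j − 1 − δ_{j,n−2k} for 1 ≤ j ≤ n−2k (i.e., m_{n−2k} ≤ a_{n−2k} − 2 and m_j ≤ a_j − 1 for j < n−2k). Then the classes of the monomials x^m = ∏_{j=1}^{n} x_j^{m_j}, for m ∈ 𝔅, form a ℂ-basis of the Milnor ring Q_w = ℂ[x_1, …, x_n]/(∂w/∂x_1, …, ∂w/∂x_n). -/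
open MvPolynomial

namespace Polynomial

variable {R : Type*} [CommRing R]

theorem X_mul_modByMonic_X_pow_add_C [Nontrivial R] {d : ℕ} (hd : 0 < d) (c : R)
    (p : R[X]) :
    (X * p) %ₘ (X ^ d + C c) =
      X * (p %ₘ (X ^ d + C c)) - C ((p %ₘ (X ^ d + C c)).coeff (d - 1)) * (X ^ d + C c) := by
  set f : R[X] := X ^ d + C c with hf_def
  have hf : f.Monic := monic_X_pow_add_C c hd.ne'
  have hfd : f.degree = d := degree_X_pow_add_C hd c
  set r := p %ₘ f with hr
  have hr_deg : r.degree < d := hfd ▸ degree_modByMonic_lt p hf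
  refine (div_modByMonic_unique (X * (p /ₘ f) + C (r.coeff (d - 1))) _ hf ⟨?_, ?_⟩).2
  · linear_combination X * modByMonic_add_div p f
  · rw [hfd, degree_lt_iff_coeff_zero]
    intro m hm
    obtain ⟨m, rfl⟩ : ∃ k, m = k + 1 := ⟨m - 1, by omega⟩
    rw [coeff_sub, coeff_X_mul, coeff_C_mul, hf_def, coeff_add, coeff_X_pow, coeff_C_succ]
    by_cases h : m + 1 = d
    · subst h; simp
    · rw [degree_lt_iff_coeff_zero] at hr_deg
      rw [hr_deg m (by omega)]
      simp [h]

/-- The polynomials whose remainder modulo `X ^ d + C c` has its `t`-th coefficient in `K t`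
for all `t < d`. -/
def remainderIdeal [Nontrivial R] {d : ℕ} (hd : 0 < d) (c : R) (K : ℕ → Ideal R)
    (hmono : ∀ t, t + 1 < d → K t ≤ K (t + 1)) (hc : ∀ k ∈ K (d - 1), c * k ∈ K 0) :
    Ideal R[X] where
  carrier := {p | ∀ t < d, (p %ₘ (X ^ d + C c)).coeff t ∈ K t}
  zero_mem' t _ := by simp
  add_mem' {p q} hp hq t ht := by
    rw [add_modByMonic, coeff_add]
    exact add_mem (hp t ht) (hq t ht)
  smul_mem' q p hp := by
    induction q using Polynomial.induction_on' with
    | add q₁ q₂ h₁ h₂ =>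
      intro t ht
      rw [add_smul, add_modByMonic, coeff_add]
      exact add_mem (h₁ t ht) (h₂ t ht)
    | monomial n b =>
      rw [← C_mul_X_pow_eq_monomial, smul_eq_mul, mul_assoc]
      intro t ht
      rw [C_mul', smul_modByMonic, coeff_smul, smul_eq_mul]
      refine Ideal.mul_mem_left _ _ ?_
      induction n generalizing t with
      | zero => simpa using hp t ht
      | succ n ih =>
        rw [pow_succ', mul_assoc, X_mul_modByMonic_X_pow_add_C hd, coeff_sub, coeff_C_mul]
        cases t with
        | zero =>
          have h := hc _ (ih (d - 1) (by omega))
          simpa [coeff_X_pow, hd.ne, mul_comm] using h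
        | succ t =>
          simpa [coeff_X_pow, coeff_C_succ, ht.ne] using hmono t ht (ih t (by omega))

theorem mem_remainderIdeal [Nontrivial R] {d : ℕ} (hd : 0 < d) (c : R) (K : ℕ → Ideal R)
    (hmono : ∀ t, t + 1 < d → K t ≤ K (t + 1)) (hc : ∀ k ∈ K (d - 1), c * k ∈ K 0) (p : R[X]) :
    p ∈ remainderIdeal hd c K hmono hc ↔ ∀ t < d, (p %ₘ (X ^ d + C c)).coeff t ∈ K t :=
  Iff.rfl

theorem modByMonic_C_mul_X_pow [Nontrivial R] {d t : ℕ} (ht : t < d) (c k : R) :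
    (C k * X ^ t) %ₘ (X ^ d + C c) = C k * X ^ t := by
  rw [modByMonic_eq_self_iff (monic_X_pow_add_C c (by omega)), degree_X_pow_add_C (by omega)]
  exact (degree_C_mul_X_pow_le t k).trans_lt (by exact_mod_cast ht)

theorem remainderIdeal_eq_span [Nontrivial R] {d : ℕ} (hd : 0 < d) (c : R) (K : ℕ → Ideal R)
    (hmono : ∀ t, t + 1 < d → K t ≤ K (t + 1)) (hc : ∀ k ∈ K (d - 1), c * k ∈ K 0) :
    remainderIdeal hd c K hmono hc =
      Ideal.span (insert (X ^ d + C c) {g | ∃ t < d, ∃ k ∈ K t, g = C k * X ^ t}) := by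
  apply le_antisymm
  · intro p hp
    rw [← modByMonic_add_div p (X ^ d + C c)]
    refine add_mem ?_ (Ideal.mul_mem_right _ _ (Ideal.subset_span (Set.mem_insert _ _)))
    have hdeg : (p %ₘ (X ^ d + C c)).natDegree < d := by
      have := natDegree_modByMonic_lt p (monic_X_pow_add_C c hd.ne') (by
        intro h
        have := congrArg natDegree h
        rw [natDegree_X_pow_add_C, natDegree_one] at this
        omega)
      rwa [natDegree_X_pow_add_C] at this
    rw [as_sum_range' _ d hdeg]
    refine sum_mem fun t ht => Ideal.subset_span (Set.mem_insert_of_mem _ ?_)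
    rw [Finset.mem_range] at ht
    exact ⟨t, ht, _, hp t ht, (C_mul_X_pow_eq_monomial).symm⟩
  · rw [Ideal.span_le]
    rintro g (rfl | ⟨t, ht, k, hk, rfl⟩) s hs
    · simp [modByMonic_self (monic_X_pow_add_C c hd.ne')]
    · rw [modByMonic_C_mul_X_pow ht, coeff_C_mul, coeff_X_pow]
      split_ifs with h
      · subst h; simpa using hk
      · simp

end Polynomial

/-- The monomial `x^m`. -/
noncomputable def monom {n : ℕ} (m : Fin n → ℕ) : MvPolynomial (Fin n) ℂ :=
  ∏ j : Fin n, X j ^ m j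

/-- The monomials with exponents in `B` form a basis modulo the ideal `I`. -/
def IsMonomialBasis {n : ℕ} (I : Ideal (MvPolynomial (Fin n) ℂ)) (B : Set (Fin n → ℕ)) : Prop :=
  ∃ b : Module.Basis B ℂ (MvPolynomial (Fin n) ℂ ⧸ I), ∀ m, b m = Ideal.Quotient.mk I (monom m.1)

/-- The embedding of polynomial rings adding a new last variable. -/
noncomputable abbrev emb {n : ℕ} : MvPolynomial (Fin n) ℂ →ₐ[ℂ] MvPolynomial (Fin (n + 1)) ℂ :=
  rename Fin.castSucc

theorem monom_succ {n : ℕ} (m : Fin (n + 1) → ℕ) :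
    monom m = emb (monom (Fin.init m)) * X (Fin.last n) ^ m (Fin.last n) := by
  simp [monom, Fin.prod_univ_castSucc, Fin.init]

/-- Polynomials in `n + 1` variables as polynomials in the last variable. -/
noncomputable def lastVarEquiv (n : ℕ) :
    MvPolynomial (Fin (n + 1)) ℂ ≃ₐ[ℂ] Polynomial (MvPolynomial (Fin n) ℂ) :=
  (renameEquiv ℂ finSuccEquivLast).trans (optionEquivLeft ℂ (Fin n))

theorem lastVarEquiv_X_last (n : ℕ) : lastVarEquiv n (X (Fin.last n)) = Polynomial.X := by
  simp [lastVarEquiv, optionEquivLeft_X_none]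

theorem lastVarEquiv_emb {n : ℕ} (p : MvPolynomial (Fin n) ℂ) :
    lastVarEquiv n (emb p) = Polynomial.C p := by
  induction p using MvPolynomial.induction_on with
  | C r => simp [lastVarEquiv, optionEquivLeft_C]
  | add p q hp hq => simp only [map_add, hp, hq]
  | mul_X p i hp =>
    rw [map_mul, map_mul, hp, map_mul]
    simp [lastVarEquiv, optionEquivLeft_X_some]

theorem isMonomialBasis_succ {n d : ℕ} (hd : 0 < d) (c : MvPolynomial (Fin n) ℂ)
    (K : ℕ → Ideal (MvPolynomial (Fin n) ℂ))
    (hmono : ∀ t, t + 1 < d → K t ≤ K (t + 1)) (hc : ∀ k ∈ K (d - 1), c * k ∈ K 0)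
    (B : ℕ → Set (Fin n → ℕ)) (hB : ∀ t < d, IsMonomialBasis (K t) (B t)) :
    IsMonomialBasis
      (Ideal.span (insert (X (Fin.last n) ^ d + emb c)
        {g | ∃ t < d, ∃ k ∈ K t, g = emb k * X (Fin.last n) ^ t}))
      {m | m (Fin.last n) < d ∧ Fin.init m ∈ B (m (Fin.last n))} := by
  set J := Ideal.span (insert (X (Fin.last n) ^ d + emb c)
        {g | ∃ t < d, ∃ k ∈ K t, g = emb k * X (Fin.last n) ^ t}) with hJ
  obtain ⟨e, heX, heC⟩ : ∃ e : MvPolynomial (Fin (n + 1)) ℂ ≃ₐ[ℂ] Polynomial (MvPolynomial (Fin n) ℂ),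
      e (X (Fin.last n)) = Polynomial.X ∧ ∀ p, e (emb p) = Polynomial.C p :=
    ⟨lastVarEquiv n, lastVarEquiv_X_last n, lastVarEquiv_emb⟩
  let f : Polynomial (MvPolynomial (Fin n) ℂ) := Polynomial.X ^ d + Polynomial.C c
  have he : J.map e = Polynomial.remainderIdeal hd c K hmono hc := by
    rw [Polynomial.remainderIdeal_eq_span, hJ, Ideal.map_span]
    congr 1
    ext g
    simp only [Set.mem_image, Set.mem_insert_iff, Set.mem_ofPred_eq]
    constructor
    · rintro ⟨_, rfl | ⟨t, ht, k, hk, rfl⟩, rfl⟩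
      · left; simp [heX, heC]
      · right; exact ⟨t, ht, k, hk, by simp [heX, heC]⟩
    · rintro (rfl | ⟨t, ht, k, hk, rfl⟩)
      · exact ⟨_, Or.inl rfl, by simp [heX, heC]⟩
      · exact ⟨_, Or.inr ⟨t, ht, k, hk, rfl⟩, by simp [heX, heC]⟩
  have hmem : ∀ p, p ∈ J ↔ ∀ t < d, (e p %ₘ f).coeff t ∈ K t := by
    intro p
    rw [← Polynomial.mem_remainderIdeal hd c K hmono hc, ← he]
    constructor
    · exact fun h => Ideal.mem_map_of_mem e h
    · intro h
      obtain ⟨q, hq, hqp⟩ := (Ideal.mem_map_iff_of_surjective e e.surjective).1 h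
      rwa [← e.injective hqp]
  let φ : MvPolynomial (Fin (n + 1)) ℂ →ₗ[ℂ] ((t : Fin d) → MvPolynomial (Fin n) ℂ ⧸ K t) :=
    { toFun := fun p t => Ideal.Quotient.mk (K t) ((e p %ₘ f).coeff t)
      map_add' := fun p q => by
        ext t; simp [Polynomial.add_modByMonic]
      map_smul' := fun r p => by
        ext t
        have : (r • e p) = (C r : MvPolynomial (Fin n) ℂ) • e p := by
          ext; simp [MvPolynomial.smul_eq_C_mul]
        simp only [map_smul, this, Polynomial.smul_modByMonic, RingHom.id_apply, Pi.smul_apply]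
        rw [Polynomial.coeff_smul, smul_eq_mul, ← MvPolynomial.smul_eq_C_mul]
        exact Submodule.Quotient.mk_smul _ _ _ }
  have hφ : ∀ (t : Fin d) k, φ (emb k * X (Fin.last n) ^ (t : ℕ)) =
      Pi.single t (Ideal.Quotient.mk (K t) k) := by
    intro t k
    ext s
    have : φ (emb k * X (Fin.last n) ^ (t : ℕ)) s = Ideal.Quotient.mk (K s)
      ((e (emb k * X (Fin.last n) ^ (t : ℕ)) %ₘ f).coeff s) := rfl
    rw [this, map_mul, map_pow, heX, heC,
      Polynomial.modByMonic_C_mul_X_pow t.2, Polynomial.coeff_C_mul, Polynomial.coeff_X_pow]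
    by_cases h : s = t
    · subst h; simp
    · have h' : (s : ℕ) ≠ t := fun h' => h (Fin.ext h')
      simp [h, h']
  have hsurj : Function.Surjective φ := by
    intro v
    choose k hk using fun t => Ideal.Quotient.mk_surjective (v t)
    refine ⟨∑ t, emb (k t) * X (Fin.last n) ^ (t : ℕ), ?_⟩
    simp_rw [map_sum, hφ, hk]
    exact Finset.univ_sum_single v
  have hker : LinearMap.ker φ = J.restrictScalars ℂ := by
    ext p
    rw [LinearMap.mem_ker, Submodule.restrictScalars_mem, hmem, _root_.funext_iff]
    simp only [φ, LinearMap.coe_mk, AddHom.coe_mk, Pi.zero_apply, Ideal.Quotient.eq_zero_iff_mem]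
    exact ⟨fun h t ht => h ⟨t, ht⟩, fun h t => h t t.2⟩
  let E : (MvPolynomial (Fin (n + 1)) ℂ ⧸ J) ≃ₗ[ℂ] ((t : Fin d) → MvPolynomial (Fin n) ℂ ⧸ K t) :=
    (Submodule.quotEquivOfEq (J.restrictScalars ℂ) _ hker.symm).trans
      (φ.quotKerEquivOfSurjective hsurj)
  have hE : ∀ p, E (Ideal.Quotient.mk J p) = φ p := fun p => rfl
  choose b hb using fun t : Fin d => hB t t.2
  let σ : ((t : Fin d) × B t) ≃
      {m : Fin (n + 1) → ℕ | m (Fin.last n) < d ∧ Fin.init m ∈ B (m (Fin.last n))} :=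
    { toFun := fun x => ⟨Fin.snoc (α := fun _ => ℕ) x.2.1 (x.1 : ℕ), by
        simp only [Set.mem_ofPred_eq, Fin.snoc_last, Fin.init_snoc]
        exact ⟨x.1.2, x.2.2⟩⟩
      invFun := fun m => ⟨⟨m.1 (Fin.last n), m.2.1⟩, ⟨Fin.init m.1, m.2.2⟩⟩
      left_inv := by
        rintro ⟨⟨t, ht⟩, ⟨m, hm⟩⟩
        simp only [Sigma.mk.injEq, Fin.snoc_last, true_and]
        congr! 1 <;> simp
      right_inv := fun m => by simp }
  refine ⟨((Pi.basis b).map E.symm).reindex σ, fun m => ?_⟩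
  rw [Module.Basis.reindex_apply, Module.Basis.map_apply, LinearEquiv.symm_apply_eq, hE,
    Pi.basis_apply, hb, monom_succ]
  exact (hφ ⟨m.1 (Fin.last n), m.2.1⟩ (monom (Fin.init m.1))).symm

theorem isMonomialBasis_of_fin_zero : IsMonomialBasis (⊥ : Ideal (MvPolynomial (Fin 0) ℂ))
    Set.univ := by
  let E : (MvPolynomial (Fin 0) ℂ ⧸ (⊥ : Ideal (MvPolynomial (Fin 0) ℂ))) ≃ₗ[ℂ] ℂ :=
    (AlgEquiv.quotientBot ℂ (MvPolynomial (Fin 0) ℂ)).toLinearEquiv.trans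
      (isEmptyAlgEquiv ℂ (Fin 0)).toLinearEquiv
  let : Unique (Set.univ : Set (Fin 0 → ℕ)) := (Equiv.Set.univ _).unique
  refine ⟨(Module.Basis.singleton (Set.univ : Set (Fin 0 → ℕ)) ℂ).map E.symm, fun m => ?_⟩
  rw [Module.Basis.map_apply, LinearEquiv.symm_apply_eq, Module.Basis.singleton_apply]
  simp [E, monom]

theorem isMonomialBasis_sup_mul_X {n d : ℕ} (hd : 0 < d) {u : ℂ} (hu : u ≠ 0)
    (I : Ideal (MvPolynomial (Fin n) ℂ)) (c y : MvPolynomial (Fin n) ℂ) {B : Set (Fin n → ℕ)}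
    (hB : IsMonomialBasis (I ⊔ Ideal.span {y * c}) B) :
    IsMonomialBasis
      (I.map emb ⊔ Ideal.span {X (Fin.last n) ^ d + emb c} ⊔
        Ideal.span {X (Fin.last n) * (C u * emb y * X (Fin.last n) ^ (d - 1))})
      {m | m (Fin.last n) < d ∧ Fin.init m ∈ B} := by
  convert isMonomialBasis_succ hd c (fun _ => I ⊔ Ideal.span {y * c}) (fun _ _ => le_rfl)
    (fun k hk => Ideal.mul_mem_left _ _ hk) (fun _ => B) (fun _ _ => hB) using 1
  have hX : (X (Fin.last n) : MvPolynomial (Fin (n + 1)) ℂ) ^ (d - 1) * X (Fin.last n)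
      = X (Fin.last n) ^ d := by rw [← pow_succ, Nat.sub_add_cancel hd]
  have huu : (C u⁻¹ * C u : MvPolynomial (Fin (n + 1)) ℂ) = 1 := by
    rw [← C_mul, inv_mul_cancel₀ hu, C_1]
  apply le_antisymm
  · set S : Ideal (MvPolynomial (Fin (n + 1)) ℂ) := Ideal.span (insert _ _)
    have hf : X (Fin.last n) ^ d + emb c ∈ S := Ideal.subset_span (Set.mem_insert _ _)
    have hK : ∀ k ∈ I ⊔ Ideal.span {y * c}, emb k ∈ S := fun k hk =>
      Ideal.subset_span (Set.mem_insert_of_mem _ ⟨0, hd, k, hk, by simp⟩)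
    refine sup_le (sup_le ?_ ?_) ?_
    · exact Ideal.map_le_iff_le_comap.2 fun k hk => hK k (Ideal.mem_sup_left hk)
    · rwa [Ideal.span_singleton_le_iff_mem]
    · rw [Ideal.span_singleton_le_iff_mem]
      have h := hK _ (Ideal.mem_sup_right (Ideal.mem_span_singleton_self (y * c)))
      rw [map_mul] at h
      convert sub_mem (S.mul_mem_left (C u * emb y) hf) (S.mul_mem_left (C u) h) using 1
      linear_combination (C u * emb y) * hX
  · set S := _ ⊔ Ideal.span {X (Fin.last n) * (C u * emb y * X (Fin.last n) ^ (d - 1))}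
    have hf : X (Fin.last n) ^ d + emb c ∈ S :=
      Ideal.mem_sup_left (Ideal.mem_sup_right (Ideal.mem_span_singleton_self _))
    have hg : X (Fin.last n) * (C u * emb y * X (Fin.last n) ^ (d - 1)) ∈ S :=
      Ideal.mem_sup_right (Ideal.mem_span_singleton_self _)
    have hK : I ⊔ Ideal.span {y * c} ≤ S.comap emb := by
      refine sup_le (fun k hk => ?_) ?_
      · exact Ideal.mem_sup_left (Ideal.mem_sup_left (Ideal.mem_map_of_mem _ hk))
      · rw [Ideal.span_singleton_le_iff_mem, Ideal.mem_comap, map_mul]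
        convert sub_mem (S.mul_mem_left (emb y) hf) (S.mul_mem_left (C u⁻¹) hg) using 1
        linear_combination (emb y * X (Fin.last n) ^ (d - 1) * X (Fin.last n)) * huu + emb y * hX
    rw [Ideal.span_le]
    rintro g (rfl | ⟨t, -, k, hk, rfl⟩)
    · exact hf
    · exact Ideal.mul_mem_right _ _ (hK hk)

theorem isMonomialBasis_sup_pow {n d : ℕ} (hd : 0 < d) {u : ℂ} (hu : u ≠ 0)
    (I : Ideal (MvPolynomial (Fin n) ℂ)) (c y : MvPolynomial (Fin n) ℂ) {B B' : Set (Fin n → ℕ)}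
    (hB : IsMonomialBasis (I ⊔ Ideal.span {y * c}) B)
    (hB' : IsMonomialBasis (I ⊔ Ideal.span {y}) B') :
    IsMonomialBasis
      (I.map emb ⊔ Ideal.span {X (Fin.last n) ^ (d + 1) + emb c} ⊔
        Ideal.span {C u * emb y * X (Fin.last n) ^ d})
      {m | (m (Fin.last n) < d ∧ Fin.init m ∈ B) ∨ (m (Fin.last n) = d ∧ Fin.init m ∈ B')} := by
  have hKK : I ⊔ Ideal.span {y * c} ≤ I ⊔ Ideal.span {y} :=
    sup_le_sup_left ((Ideal.span_singleton_le_span_singleton).2 (dvd_mul_right _ _)) _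
  convert isMonomialBasis_succ d.succ_pos c
    (fun t => if t < d then I ⊔ Ideal.span {y * c} else I ⊔ Ideal.span {y}) (fun t ht => ?_)
    (fun k hk => ?_) (fun t => if t < d then B else B') (fun t ht => ?_) using 1
  · apply le_antisymm
    · set S : Ideal (MvPolynomial (Fin (n + 1)) ℂ) := Ideal.span (insert _ _)
      have hf : X (Fin.last n) ^ (d + 1) + emb c ∈ S := Ideal.subset_span (Set.mem_insert _ _)
      refine sup_le (sup_le ?_ ?_) ?_
      · refine Ideal.map_le_iff_le_comap.2 fun k hk =>
          Ideal.subset_span (Set.mem_insert_of_mem _ ⟨0, d.succ_pos, k, ?_, by simp⟩)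
        rw [if_pos hd]
        exact Ideal.mem_sup_left hk
      · rwa [Ideal.span_singleton_le_iff_mem]
      · rw [Ideal.span_singleton_le_iff_mem, mul_assoc]
        refine S.mul_mem_left _ (Ideal.subset_span (Set.mem_insert_of_mem _
          ⟨d, d.lt_succ_self, y, ?_, rfl⟩))
        rw [if_neg (lt_irrefl d)]
        exact Ideal.mem_sup_right (Ideal.mem_span_singleton_self y)
    · set S := _ ⊔ Ideal.span {C u * emb y * X (Fin.last n) ^ d}
      have hf : X (Fin.last n) ^ (d + 1) + emb c ∈ S :=
        Ideal.mem_sup_left (Ideal.mem_sup_right (Ideal.mem_span_singleton_self _))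
      have hg : emb y * X (Fin.last n) ^ d ∈ S := by
        have h : C u * emb y * X (Fin.last n) ^ d ∈ S :=
          Ideal.mem_sup_right (Ideal.mem_span_singleton_self _)
        have h' := S.mul_mem_left (C u⁻¹) h
        rwa [mul_assoc, ← mul_assoc, ← C_mul, inv_mul_cancel₀ hu, C_1, one_mul] at h'
      have hI : I ≤ S.comap emb := fun k hk =>
        Ideal.mem_sup_left (Ideal.mem_sup_left (Ideal.mem_map_of_mem _ hk))
      rw [Ideal.span_le]
      rintro g (rfl | ⟨t, ht, k, hk, rfl⟩)
      · exact hf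
      · split_ifs at hk with htd
        · refine Ideal.mul_mem_right _ _ ?_
          refine (sup_le hI ?_ : _ ≤ S.comap emb) hk
          rw [Ideal.span_singleton_le_iff_mem, Ideal.mem_comap, map_mul]
          convert sub_mem (S.mul_mem_left (emb y) hf) (S.mul_mem_left (X (Fin.last n)) hg) using 1
          ring
        · obtain rfl : t = d := by omega
          obtain ⟨i, hi, j, hj, rfl⟩ := Submodule.mem_sup.1 hk
          obtain ⟨r, rfl⟩ := Ideal.mem_span_singleton.1 hj
          rw [map_add, add_mul, map_mul, mul_right_comm]
          exact add_mem (Ideal.mul_mem_right _ _ (hI hi)) (Ideal.mul_mem_right _ _ hg)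
  · ext m
    simp only [Set.mem_ofPred_eq]
    by_cases h : m (Fin.last n) < d
    · simp [h, h.ne, h.trans d.lt_succ_self]
    · simp only [h, if_false, false_and, false_or]
      exact and_congr_left' (by omega)
  · split_ifs
    · exact le_rfl
    · exact hKK
    · omega
    · exact le_rfl
  · rw [if_neg (by omega)] at hk
    rw [if_pos hd]
    obtain ⟨i, hi, j, hj, rfl⟩ := Submodule.mem_sup.1 hk
    obtain ⟨r, rfl⟩ := Ideal.mem_span_singleton.1 hj
    rw [mul_add]
    refine add_mem (Ideal.mem_sup_left (I.mul_mem_left _ hi)) (Ideal.mem_sup_right ?_)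
    exact Ideal.mem_span_singleton.2 ⟨r, by ring⟩
  · split_ifs
    exacts [hB, hB']

theorem isMonomialBasis_sup_X {n d : ℕ} (hd : 0 < d)
    (I : Ideal (MvPolynomial (Fin n) ℂ)) (c : MvPolynomial (Fin n) ℂ) {B : Set (Fin n → ℕ)}
    (hB : IsMonomialBasis (I ⊔ Ideal.span {c}) B) :
    IsMonomialBasis
      (I.map emb ⊔ Ideal.span {X (Fin.last n) ^ d + emb c} ⊔ Ideal.span {X (Fin.last n)})
      {m | m (Fin.last n) = 0 ∧ Fin.init m ∈ B} := by
  convert isMonomialBasis_succ one_pos 0 (fun _ => I ⊔ Ideal.span {c}) (fun _ _ => le_rfl)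
    (fun k hk => by simp) (fun _ => B) (fun _ _ => hB) using 1
  · have hX : (X (Fin.last n) : MvPolynomial (Fin (n + 1)) ℂ) ^ (d - 1) * X (Fin.last n)
        = X (Fin.last n) ^ d := by rw [← pow_succ, Nat.sub_add_cancel hd]
    apply le_antisymm
    · set S : Ideal (MvPolynomial (Fin (n + 1)) ℂ) := Ideal.span (insert _ _)
      have hf : X (Fin.last n) ∈ S := by
        have : X (Fin.last n) ^ 1 + emb 0 ∈ S := Ideal.subset_span (Set.mem_insert _ _)
        simpa using this
      have hK : ∀ k ∈ I ⊔ Ideal.span {c}, emb k ∈ S := fun k hk =>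
        Ideal.subset_span (Set.mem_insert_of_mem _ ⟨0, one_pos, k, hk, by simp⟩)
      refine sup_le (sup_le ?_ ?_) ?_
      · exact Ideal.map_le_iff_le_comap.2 fun k hk => hK k (Ideal.mem_sup_left hk)
      · rw [Ideal.span_singleton_le_iff_mem, ← hX]
        exact add_mem (S.mul_mem_left _ hf)
          (hK c (Ideal.mem_sup_right (Ideal.mem_span_singleton_self c)))
      · rwa [Ideal.span_singleton_le_iff_mem]
    · set S : Ideal (MvPolynomial (Fin (n + 1)) ℂ) := _ ⊔ Ideal.span {X (Fin.last n)}
      have hf : X (Fin.last n) ^ d + emb c ∈ S :=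
        Ideal.mem_sup_left (Ideal.mem_sup_right (Ideal.mem_span_singleton_self _))
      have hg : X (Fin.last n) ∈ S := Ideal.mem_sup_right (Ideal.mem_span_singleton_self _)
      have hK : I ⊔ Ideal.span {c} ≤ S.comap emb := by
        refine sup_le (fun k hk => ?_) ?_
        · exact Ideal.mem_sup_left (Ideal.mem_sup_left (Ideal.mem_map_of_mem _ hk))
        · rw [Ideal.span_singleton_le_iff_mem, Ideal.mem_comap]
          rw [← hX] at hf
          exact (Ideal.add_mem_iff_right S (S.mul_mem_left _ hg)).1 hf
      rw [Ideal.span_le]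
      rintro g (rfl | ⟨t, -, k, hk, rfl⟩)
      · simpa using hg
      · exact Ideal.mul_mem_right _ _ (hK hk)
  · simp

/-- The last of the `n` variables, or `1` if there are none. -/
noncomputable def lastVar : (n : ℕ) → MvPolynomial (Fin n) ℂ
  | 0 => 1
  | n + 1 => X (Fin.last n)

/-- The dual chain polynomial in `n` variables with exponents `a`. -/
noncomputable def dualChain (a : ℕ → ℕ) : (n : ℕ) → MvPolynomial (Fin n) ℂ
  | 0 => 0
  | n + 1 => emb (dualChain a n) + emb (lastVar n) * X (Fin.last n) ^ a n

/-- The derivative of the dual chain polynomial with respect to the last variable. -/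
noncomputable def lastDeriv (a : ℕ → ℕ) : (n : ℕ) → MvPolynomial (Fin n) ℂ
  | 0 => 0
  | n + 1 => C (a n : ℂ) * emb (lastVar n) * X (Fin.last n) ^ (a n - 1)

/-- The ideal generated by the derivatives of the dual chain polynomial with respect to all
variables but the last. -/
noncomputable def initIdeal (a : ℕ → ℕ) : (n : ℕ) → Ideal (MvPolynomial (Fin n) ℂ)
  | 0 => ⊥
  | 1 => ⊥
  | n + 2 => (initIdeal a (n + 1)).map emb ⊔
      Ideal.span {X (Fin.last (n + 1)) ^ a (n + 1) + emb (lastDeriv a (n + 1))}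

/-- Kreuzer's standard index set, described recursively. -/
def standardSet (a : ℕ → ℕ) : (n : ℕ) → Set (Fin n → ℕ)
  | 0 => Set.univ
  | 1 => {m | m 0 < a 0 - 1}
  | n + 2 => {m | (m (Fin.last (n + 1)) < a (n + 1) - 1 ∧ ∀ j, Fin.init m j < a j) ∨
      (m (Fin.last (n + 1)) = a (n + 1) - 1 ∧ Fin.init m (Fin.last n) = 0 ∧
        Fin.init (Fin.init m) ∈ standardSet a n)}

theorem isMonomialBasis_of_fin_one {d : ℕ} (hd : 0 < d) {u : ℂ} (hu : u ≠ 0) :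
    IsMonomialBasis (Ideal.span {C u * X 0 ^ d} : Ideal (MvPolynomial (Fin 1) ℂ))
      {m | m 0 < d} := by
  convert isMonomialBasis_succ hd 0 (fun _ => ⊥) (fun _ _ => le_rfl)
    (fun k hk => by simp) (fun _ => Set.univ) (fun _ _ => isMonomialBasis_of_fin_zero) using 1
  · have hS : {g : MvPolynomial (Fin (0 + 1)) ℂ | ∃ t < d, ∃ k ∈ (⊥ : Ideal (MvPolynomial (Fin 0) ℂ)),
        g = emb k * X (Fin.last 0) ^ t} = {0} := by
      ext g
      constructor
      · rintro ⟨t, -, k, hk, rfl⟩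
        rw [Ideal.mem_bot.1 hk]
        simp
      · rintro rfl
        exact ⟨0, hd, 0, by simp, by simp⟩
    rw [hS, map_zero, add_zero, Set.pair_comm, Ideal.span_insert_zero,
      Ideal.span_singleton_mul_left_unit (hu.isUnit.map C)]
    rfl
  · simp

theorem isMonomialBasis_box (a : ℕ → ℕ) (n : ℕ) (ha : ∀ i < n + 1, 0 < a i) :
    IsMonomialBasis (initIdeal a (n + 1) ⊔ Ideal.span {lastVar (n + 1) * lastDeriv a (n + 1)})
      {m | ∀ j, m j < a j} := by
  induction n with
  | zero =>
    have h0 := ha 0 one_pos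
    convert isMonomialBasis_of_fin_one h0 (Nat.cast_ne_zero.2 h0.ne' : (a 0 : ℂ) ≠ 0) using 1
    · simp only [initIdeal, lastVar, lastDeriv, bot_sup_eq, map_one, mul_one]
      rw [mul_left_comm, ← pow_succ', Nat.sub_add_cancel h0]
      rfl
    · ext m; simp [Fin.forall_fin_one]
  | succ n ih =>
    have h := ha (n + 1) (Nat.lt_succ_self _)
    convert isMonomialBasis_sup_mul_X h (Nat.cast_ne_zero.2 h.ne' : (a (n + 1) : ℂ) ≠ 0) _ _ _
      (ih fun i hi => ha i (hi.trans (Nat.lt_succ_self _))) using 1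
    · rfl
    · ext m
      simp [Fin.forall_fin_succ', Fin.init, and_comm]

theorem isMonomialBasis_standardSet (a : ℕ → ℕ) (n : ℕ) (ha : ∀ i < n, 2 ≤ a i) :
    IsMonomialBasis (initIdeal a n ⊔ Ideal.span {lastDeriv a n}) (standardSet a n) := by
  induction n using Nat.twoStepInduction with
  | zero => simpa [initIdeal, lastDeriv, standardSet] using isMonomialBasis_of_fin_zero
  | one =>
    have h0 := ha 0 one_pos
    convert isMonomialBasis_of_fin_one (d := a 0 - 1) (u := a 0) (by omega)
      (Nat.cast_ne_zero.2 (by omega)) using 1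
    · simp only [initIdeal, lastVar, lastDeriv, bot_sup_eq, map_one, mul_one]
      rfl
    · rfl
  | more n ih _ =>
    have h := ha (n + 1) (by omega)
    have hQ : IsMonomialBasis (initIdeal a (n + 1) ⊔ Ideal.span {lastVar (n + 1)})
        {m | m (Fin.last n) = 0 ∧ Fin.init m ∈ standardSet a n} := by
      have ihn := ih fun i hi => ha i (by omega)
      cases n with
      | zero =>
        convert isMonomialBasis_of_fin_one one_pos one_ne_zero using 1
        · simp [initIdeal, lastVar]
        · simp [standardSet]
      | succ n =>
        exact isMonomialBasis_sup_X (by have := ha (n + 1) (by omega); omega) _ _ ihn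
    convert isMonomialBasis_sup_pow (d := a (n + 1) - 1) (u := a (n + 1)) (by omega)
      (Nat.cast_ne_zero.2 (by omega)) _ _ _
      (isMonomialBasis_box a n fun i hi => by have := ha i (by omega); omega) hQ using 1
    · rw [Nat.sub_add_cancel (by omega)]
      rfl
    · rfl

theorem pderiv_last_emb {n : ℕ} (p : MvPolynomial (Fin n) ℂ) :
    pderiv (Fin.last n) (emb p) = 0 := by
  induction p using MvPolynomial.induction_on with
  | C r => simp
  | add p q hp hq => simp only [map_add, hp, hq, add_zero]
  | mul_X p i hp => simp [hp, pderiv_X_of_ne i.castSucc_lt_last.ne]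

theorem pderiv_last_dualChain (a : ℕ → ℕ) (n : ℕ) :
    pderiv (Fin.last n) (dualChain a (n + 1)) = lastDeriv a (n + 1) := by
  simp only [dualChain, lastDeriv, map_add, pderiv_mul, pderiv_last_emb, pderiv_pow, pderiv_X_self]
  simp
  ring

theorem pderiv_castSucc_dualChain (a : ℕ → ℕ) (n : ℕ) (i : Fin n) :
    pderiv i.castSucc (dualChain a (n + 1)) = emb (pderiv i (dualChain a n)) +
      emb (pderiv i (lastVar n)) * X (Fin.last n) ^ a n := by
  simp only [dualChain, map_add, pderiv_mul, pderiv_rename (Fin.castSucc_injective n), pderiv_pow,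
    pderiv_X_of_ne i.castSucc_lt_last.ne']
  simp

theorem initIdeal_eq_span (a : ℕ → ℕ) (n : ℕ) :
    initIdeal a (n + 1) =
      Ideal.span (Set.range fun i : Fin n => pderiv i.castSucc (dualChain a (n + 1))) := by
  induction n with
  | zero => simp [initIdeal]
  | succ n ih =>
    rw [initIdeal, ih, Ideal.map_span, ← Ideal.span_union]
    congr 1
    ext g
    simp only [Set.mem_union, Set.mem_image, Set.mem_range, Set.mem_singleton_iff,
      exists_exists_eq_and, Fin.exists_fin_succ', pderiv_castSucc_dualChain a (n + 1)]
    refine or_congr (exists_congr fun i => ?_) ?_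
    · rw [lastVar, pderiv_X_of_ne i.castSucc_lt_last.ne']
      simp
    · rw [lastVar, pderiv_X_self, pderiv_last_dualChain, map_one, one_mul, add_comm (emb _)]
      exact eq_comm

theorem span_range_pderiv_dualChain (a : ℕ → ℕ) (n : ℕ) :
    Ideal.span (Set.range fun i => pderiv i (dualChain a n)) =
      initIdeal a n ⊔ Ideal.span {lastDeriv a n} := by
  cases n with
  | zero => simp [initIdeal, lastDeriv]
  | succ n =>
    rw [initIdeal_eq_span, ← Ideal.span_union]
    congr 1
    ext g
    simp [Fin.exists_fin_succ', pderiv_last_dualChain, eq_comm, or_comm]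

theorem dualChain_eq_sum (a : ℕ → ℕ) (n : ℕ) :
    dualChain a n = ∑ i : Fin n,
      if (i : ℕ) = 0 then X i ^ a (i : ℕ)
      else X (⟨(i : ℕ) - 1, Nat.lt_of_le_of_lt (Nat.sub_le _ _) i.isLt⟩ : Fin n) *
        X i ^ a (i : ℕ) := by
  induction n with
  | zero => simp [dualChain]
  | succ n ih =>
    rw [Fin.sum_univ_castSucc, dualChain, ih, map_sum]
    congr 1
    · refine Finset.sum_congr rfl fun i _ => ?_
      rw [apply_ite emb]
      simp
    · cases n with
      | zero => simp [lastVar]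
      | succ n => simp [lastVar]; rfl

theorem mem_standardSet_iff (a : ℕ → ℕ) (n : ℕ) (ha : ∀ i < n, 2 ≤ a i) (m : Fin n → ℕ) :
    m ∈ standardSet a n ↔ ∃ k, k ≤ n / 2 ∧ ∀ j : Fin n,
      ((j : ℕ) < n - 2 * k →
        m j ≤ a (j : ℕ) - 1 - (if (j : ℕ) = n - 2 * k - 1 then 1 else 0)) ∧
      (n - 2 * k ≤ (j : ℕ) →
        ((n - 1 - (j : ℕ)) % 2 = 0 → m j = a (j : ℕ) - 1) ∧
        ((n - 1 - (j : ℕ)) % 2 = 1 → m j = 0)) := by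
  induction n using Nat.twoStepInduction with
  | zero => simp [standardSet]
  | one =>
    have := ha 0 one_pos
    simp [standardSet]
    omega
  | more n ih _ =>
    have hl := ha (n + 1) (by omega)
    rw [standardSet, Set.mem_ofPred_eq, ih fun i hi => ha i (by omega)]
    simp only [Fin.init]
    constructor
    · rintro (⟨h1, h2⟩ | ⟨h1, h2, k, hk, h3⟩)
      · refine ⟨0, by omega, fun j => ⟨fun _ => ?_, fun h => by omega⟩⟩
        cases j using Fin.lastCases with
        | last => simp; omega
        | cast j =>
          have := h2 j
          have := j.2
          simp only [Fin.val_castSucc]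
          rw [if_neg (by omega)]
          omega
      · refine ⟨k + 1, by omega, fun j => ?_⟩
        cases j using Fin.lastCases with
        | last =>
          simp only [Fin.val_last]
          exact ⟨fun h => by omega, fun _ => ⟨fun _ => h1, fun h => by omega⟩⟩
        | cast j =>
          cases j using Fin.lastCases with
          | last =>
            simp only [Fin.val_last, Fin.val_castSucc]
            exact ⟨fun h => by omega, fun _ => ⟨fun h => by omega, fun _ => h2⟩⟩
          | cast j =>
            have := h3 j
            have := j.2
            simp only [Fin.val_castSucc]
            rw [show n + 2 - 2 * (k + 1) = n - 2 * k by omega,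
              show (n + 2 - 1 - (j : ℕ)) % 2 = (n - 1 - (j : ℕ)) % 2 by omega]
            assumption
    · rintro ⟨k, hk, h⟩
      cases k with
      | zero =>
        left
        constructor
        · have := (h (Fin.last _)).1 (by simp)
          simp at this
          omega
        · intro j
          have := (h j.castSucc).1 (by have := j.2; simp; omega)
          simp only [Fin.val_castSucc] at this
          have := ha j (by have := j.2; omega)
          omega
      | succ k =>
        right
        refine ⟨((h (Fin.last _)).2 (by simp; omega)).1 (by simp),
          ((h (Fin.last n).castSucc).2 (by simp)).2 (by simp), k, by omega, fun j => ?_⟩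
        have := h j.castSucc.castSucc
        have := j.2
        simp only [Fin.val_castSucc] at *
        rw [show n + 2 - 2 * (k + 1) = n - 2 * k by omega,
          show (n + 2 - 1 - (j : ℕ)) % 2 = (n - 1 - (j : ℕ)) % 2 by omega] at *
        assumption

/-- The classes of the monomials `x^m`, for `m` in Kreuzer's
standard index set `𝔅` of the dual chain polynomial
`w = x_1^{a_1} + ∑_{i=2}^{n} x_{i−1} x_i^{a_i}`, form a `ℂ`-basis of the Milnor
ring `Q_w`. Indices are `0`-based via `Fin n`: the `1`-based position of
`j : Fin n` is `j + 1`, the stratum `𝔅^k` requires, for positions `> n − 2k`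
(`0`-based `(j : ℕ) ≥ n − 2k`), `m j = a j − 1` when `n − 1 − j` is even and
`m j = 0` when it is odd, and for positions `≤ n − 2k` (`0`-based
`(j : ℕ) < n − 2k`), `m j ≤ a j − 1 − δ_{j, n−2k−1}`. -/
theorem dual_chain_standard_basis {n : ℕ} (hn : 1 ≤ n) (a : ℕ → ℕ)
    (ha : ∀ i < n, 2 ≤ a i)
    (w : MvPolynomial (Fin n) ℂ)
    (hw : w = ∑ i : Fin n,
      if (i : ℕ) = 0 then X i ^ a (i : ℕ)
      else X (⟨(i : ℕ) - 1, Nat.lt_of_le_of_lt (Nat.sub_le _ _) i.isLt⟩ : Fin n) *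
        X i ^ a (i : ℕ))
    (J : Ideal (MvPolynomial (Fin n) ℂ))
    (hJ : J = Ideal.span (Set.range fun i => MvPolynomial.pderiv i w))
    (B : Set (Fin n → ℕ))
    (hB : B = {m | ∃ k, k ≤ n / 2 ∧ ∀ j : Fin n,
      ((j : ℕ) < n - 2 * k →
        m j ≤ a (j : ℕ) - 1 - (if (j : ℕ) = n - 2 * k - 1 then 1 else 0)) ∧
      (n - 2 * k ≤ (j : ℕ) →
        ((n - 1 - (j : ℕ)) % 2 = 0 → m j = a (j : ℕ) - 1) ∧
        ((n - 1 - (j : ℕ)) % 2 = 1 → m j = 0))}) :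
    LinearIndependent ℂ (fun m : B =>
        Ideal.Quotient.mk J (∏ j : Fin n, X j ^ (m : Fin n → ℕ) j)) ∧
      Submodule.span ℂ (Set.range (fun m : B =>
        Ideal.Quotient.mk J (∏ j : Fin n, X j ^ (m : Fin n → ℕ) j))) = ⊤ := by
  have hBs : B = standardSet a n := by
    ext m
    rw [mem_standardSet_iff a n ha, hB]
    rfl
  have hJs : J = initIdeal a n ⊔ Ideal.span {lastDeriv a n} := by
    rw [hJ, hw, ← dualChain_eq_sum, span_range_pderiv_dualChain]
  obtain ⟨b, hb⟩ : IsMonomialBasis J B := by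
    rw [hBs, hJs]
    exact isMonomialBasis_standardSet a n ha
  have hb' : (fun m : B => Ideal.Quotient.mk J (∏ j : Fin n, X j ^ (m : Fin n → ℕ) j)) = b :=
    funext fun m => (hb m).symm
  rw [hb']
  exact ⟨b.linearIndependent, b.span_eq⟩
end

section
/- Let n ≥ 2 and let a_1, …, a_n be integers with a_i ≥ 2, and let w = x_n x_1^{a_1} + Σ_{i=2}^{n} x_{i−1} x_i^{a_i} ∈ ℂ[x_1, …, x_n]. Then the classes of the monomials x^m = ∏_{j=1}^{n} x_j^{m_j}, where m ∈ ℕ^n ranges over all vectors with 0 ≤ m_j ≤ a_j − 1 for every j, form a ℂ-basis of the Milnor ring Q_w = ℂ[x_1, …, x_n]/(∂w/∂x_1, …, ∂w/∂x_n). -/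
open MvPolynomial

namespace BinomialReduction

variable {ι K : Type*} [DecidableEq ι] [Field K]

/-- Rewriting the factor `x_j ^ a_j` of a monomial `x ^ m` into `x ^ r_j`, on exponents. -/
noncomputable def reduce (a : ι → ℕ) (r : ι → ι →₀ ℕ) (j : ι) (m : ι →₀ ℕ) : ι →₀ ℕ :=
  m - Finsupp.single j (a j) + r j

open Classical in
/-- The coefficient of `x ^ s` in the normal form of `x ^ m` under the rewriting rules
`x_j ^ a_j ↦ c_j x ^ r_j`, as far as it is visible after at most `k` steps. -/
noncomputable def coeffAfter (a : ι → ℕ) (c : ι → K) (r : ι → ι →₀ ℕ) (s : ι →₀ ℕ) :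
    ℕ → (ι →₀ ℕ) → K
  | 0, m => if m = s then 1 else 0
  | k + 1, m =>
    if h : ∃ j, a j ≤ m j then c h.choose * coeffAfter a c r s k (reduce a r h.choose m)
    else if m = s then 1 else 0

variable {a : ι → ℕ} {c : ι → K} {r : ι → ι →₀ ℕ} {s : ι →₀ ℕ}

theorem le_reduce {i j : ι} (hij : i ≠ j) {m : ι →₀ ℕ} (hi : a i ≤ m i) :
    a i ≤ reduce a r j m i := by
  simp only [reduce, Finsupp.add_apply, Finsupp.tsub_apply, Finsupp.single_apply,
    if_neg hij.symm]
  omega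

theorem reduce_comm {i j : ι} (hij : i ≠ j) {m : ι →₀ ℕ} (hi : a i ≤ m i) (hj : a j ≤ m j) :
    reduce a r i (reduce a r j m) = reduce a r j (reduce a r i m) := by
  ext l
  simp only [reduce, Finsupp.add_apply, Finsupp.tsub_apply, Finsupp.single_apply]
  by_cases h1 : i = l
  · subst h1
    simp only [if_neg hij.symm, if_true]
    omega
  · by_cases h2 : j = l
    · subst h2
      simp only [if_neg hij, if_true]
      omega
    · simp only [if_neg h1, if_neg h2]
      omega

theorem coeffAfter_zero_of_le (hs : ∀ j, s j < a j) {m : ι →₀ ℕ} {j : ι} (hj : a j ≤ m j) :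
    coeffAfter a c r s 0 m = 0 := by
  rw [coeffAfter, if_neg]
  rintro rfl
  exact absurd (hs j) (not_lt.mpr hj)

theorem coeffAfter_succ (hs : ∀ j, s j < a j) (k : ℕ) {m : ι →₀ ℕ} {j : ι} (hj : a j ≤ m j) :
    coeffAfter a c r s (k + 1) m = c j * coeffAfter a c r s k (reduce a r j m) := by
  induction k generalizing m j with
  | zero =>
    have h : ∃ j, a j ≤ m j := ⟨j, hj⟩
    rw [coeffAfter.eq_2, dif_pos h]
    by_cases hij : h.choose = j
    · rw [hij]
    · rw [coeffAfter_zero_of_le hs (le_reduce (Ne.symm hij) hj),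
        coeffAfter_zero_of_le hs (le_reduce hij h.choose_spec), mul_zero, mul_zero]
  | succ k ih =>
    have h : ∃ j, a j ≤ m j := ⟨j, hj⟩
    rw [coeffAfter.eq_2, dif_pos h]
    by_cases hij : h.choose = j
    · rw [hij]
    · rw [ih (le_reduce (Ne.symm hij) hj), ih (le_reduce hij h.choose_spec),
        reduce_comm hij h.choose_spec hj, mul_left_comm]

theorem coeffAfter_stable (hs : ∀ j, s j < a j) (k : ℕ) {m : ι →₀ ℕ}
    (h0 : coeffAfter a c r s k m ≠ 0) :
    coeffAfter a c r s (k + 1) m = coeffAfter a c r s k m := by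
  induction k generalizing m with
  | zero =>
    have h : ¬ ∃ j, a j ≤ m j := fun ⟨j, hj⟩ => h0 (coeffAfter_zero_of_le hs hj)
    rw [coeffAfter.eq_2, dif_neg h, coeffAfter]
  | succ k ih =>
    by_cases h : ∃ j, a j ≤ m j
    · obtain ⟨j, hj⟩ := h
      rw [coeffAfter_succ hs k hj] at h0 ⊢
      rw [coeffAfter_succ hs _ hj, ih (right_ne_zero_of_mul h0)]
    · rw [coeffAfter, dif_neg h, coeffAfter, dif_neg h]

theorem exists_eventually_coeffAfter (hs : ∀ j, s j < a j) (m : ι →₀ ℕ) :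
    ∃ v, ∀ᶠ k in Filter.atTop, coeffAfter a c r s k m = v := by
  by_cases h : ∃ k, coeffAfter a c r s k m ≠ 0
  · obtain ⟨k, hk⟩ := h
    refine ⟨coeffAfter a c r s k m, Filter.eventually_atTop.mpr ⟨k, fun l hl => ?_⟩⟩
    induction l, hl using Nat.le_induction with
    | base => rfl
    | succ l _ ih => rw [coeffAfter_stable hs l (ih ▸ hk), ih]
  · push Not at h
    exact ⟨0, Filter.Eventually.of_forall h⟩

/-- Each exponent `s` that is irreducible is detected by a function on exponents that is compatible
with the rewriting rules. -/
theorem exists_potential (c : ι → K) (r : ι → ι →₀ ℕ) (hs : ∀ j, s j < a j) :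
    ∃ v : (ι →₀ ℕ) → K, (∀ j m, v (m + Finsupp.single j (a j)) = c j * v (m + r j)) ∧
      v s = 1 ∧ ∀ m, (∀ j, m j < a j) → m ≠ s → v m = 0 := by
  choose v hv using exists_eventually_coeffAfter (c := c) (r := r) hs
  have irred (m : ι →₀ ℕ) (hm : ∀ j, m j < a j) : v m = if m = s then 1 else 0 := by
    obtain ⟨k, hk⟩ := (hv m).exists
    rw [← hk]
    have h : ¬ ∃ j, a j ≤ m j := by simpa using hm
    cases k with
    | zero => rw [coeffAfter]
    | succ k => rw [coeffAfter, dif_neg h]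
  refine ⟨v, fun j m => ?_, by simp [irred s hs], fun m hm hne => by simp [irred m hm, hne]⟩
  obtain ⟨k, h1, h2⟩ := (((Filter.tendsto_add_atTop_nat 1).eventually
    (hv (m + Finsupp.single j (a j)))).and (hv (m + r j))).exists
  rw [← h1, ← h2, coeffAfter_succ hs k (j := j) (by simp), reduce, add_tsub_cancel_right]

/-- Irreducible monomials are linearly independent modulo binomials `x_j ^ a_j - c_j x ^ r_j`. -/
theorem linearIndependent_irreducible (a : ι → ℕ) (c : ι → K) (r : ι → ι →₀ ℕ)
    (J : Ideal (MvPolynomial ι K))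
    (hJ : J = Ideal.span (Set.range fun j =>
      monomial (Finsupp.single j (a j)) 1 - monomial (r j) (c j))) :
    LinearIndependent K (fun m : {m : ι →₀ ℕ // ∀ j, m j < a j} =>
      Ideal.Quotient.mk J (monomial (m : ι →₀ ℕ) 1)) := by
  rw [linearIndependent_iff']
  intro t g hg s hst
  obtain ⟨v, hv, hvs, hv0⟩ := exists_potential c r s.2
  let L : MvPolynomial ι K →ₗ[K] K := (basisMonomials ι K).constr K v
  have hL (m : ι →₀ ℕ) (b : K) : L (monomial m b) = b * v m := by
    have h1 : L (monomial m 1) = v m := by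
      simpa only [coe_basisMonomials] using (basisMonomials ι K).constr_basis K v m
    rw [← mul_one b, ← smul_eq_mul, ← smul_monomial, map_smul, h1, smul_eq_mul, smul_eq_mul,
      mul_one]
  have hLJ : ∀ p ∈ J, ∀ q, L (q * p) = 0 := by
    intro p hp
    rw [hJ] at hp
    induction hp using Submodule.span_induction with
    | mem p hp =>
      obtain ⟨j, rfl⟩ := hp
      intro q
      induction q using MvPolynomial.induction_on' with
      | monomial m b =>
        simp only [mul_sub, monomial_mul, map_sub, hL, hv, mul_one]
        ring
      | add p q hp hq => rw [add_mul, map_add, hp, hq, add_zero]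
    | zero => simp
    | add x y _ _ hx hy => intro q; rw [mul_add, map_add, hx, hy, add_zero]
    | smul b x _ hx => intro q; rw [smul_eq_mul, ← mul_assoc, hx]
  have hmem : ∑ m ∈ t, g m • monomial (m : ι →₀ ℕ) (1 : K) ∈ J := by
    rw [← Ideal.Quotient.eq_zero_iff_mem, map_sum, ← hg]
    rfl
  have h := hLJ _ hmem 1
  rw [one_mul, map_sum, Finset.sum_eq_single s] at h
  · simpa [hL, hvs] using h
  · intro m _ hm
    rw [map_smul, hL, hv0 m m.2 (fun h => hm (Subtype.ext h)), mul_zero, smul_zero]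
  · exact fun h => absurd hst h

/-- Irreducible monomials span modulo binomials `x_j ^ a_j - c_j x ^ r_j` that are homogeneous for
some positive weights and have `‖c_j‖ > 1`. -/
theorem span_irreducible {K : Type*} [NormedField K] [Finite ι] (a : ι → ℕ) (c : ι → K)
    (r : ι → ι →₀ ℕ) (J : Ideal (MvPolynomial ι K))
    (hJ : J = Ideal.span (Set.range fun j =>
      monomial (Finsupp.single j (a j)) 1 - monomial (r j) (c j)))
    (hc : ∀ j, 1 < ‖c j‖) (q : ι → ℝ) (hq : ∀ j, 0 < q j)
    (hqr : ∀ j, Finsupp.weight q (r j) = a j * q j) :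
    Submodule.span K (Set.range (fun m : {m : ι →₀ ℕ // ∀ j, m j < a j} =>
      Ideal.Quotient.mk J (monomial (m : ι →₀ ℕ) 1))) = ⊤ := by
  set S := Submodule.span K (Set.range (fun m : {m : ι →₀ ℕ // ∀ j, m j < a j} =>
      Ideal.Quotient.mk J (monomial (m : ι →₀ ℕ) 1)))
  have step (j : ι) (m : ι →₀ ℕ) :
      Ideal.Quotient.mk J (monomial (m + Finsupp.single j (a j)) (1 : K)) =
        c j • Ideal.Quotient.mk J (monomial (m + r j) (1 : K)) := by
    have h : monomial m 1 * (monomial (Finsupp.single j (a j)) 1 - monomial (r j) (c j)) ∈ J :=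
      J.mul_mem_left _ (hJ ▸ Ideal.subset_span ⟨j, rfl⟩)
    rw [mul_sub, monomial_mul, monomial_mul, one_mul, one_mul, ← Ideal.Quotient.eq] at h
    rw [h, ← mul_one (c j), ← smul_eq_mul, ← smul_monomial, smul_eq_mul, mul_one]
    rfl
  have key (m : ι →₀ ℕ) : Ideal.Quotient.mk J (monomial m (1 : K)) ∈ S := by
    by_contra hm
    obtain ⟨φ, hφm, hφS⟩ := Submodule.exists_le_ker_of_notMem hm
    let W : Set (ι →₀ ℕ) := {m' | Finsupp.weight q m' = Finsupp.weight q m ∧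
      φ (Ideal.Quotient.mk J (monomial m' (1 : K))) ≠ 0}
    have hW : W.Finite := by
      have hfin : {m' : ι → ℕ | ∀ j, m' j ≤ ⌊Finsupp.weight q m / q j⌋₊}.Finite := by
        have := Set.Finite.pi' (fun j => Set.finite_Iic ⌊Finsupp.weight q m / q j⌋₊)
        simpa using this
      refine (hfin.preimage (f := fun m' : ι →₀ ℕ => (m' : ι → ℕ))
        DFunLike.coe_injective.injOn).subset ?_
      rintro m' ⟨hm', -⟩ j
      refine Nat.le_floor ?_
      beta_reduce
      rw [le_div_iff₀ (hq j), ← hm', Finsupp.weight_apply, Finsupp.sum]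
      by_cases hj : j ∈ m'.support
      · rw [← nsmul_eq_mul]
        exact Finset.single_le_sum (f := fun i => m' i • q i)
          (fun i _ => nsmul_nonneg (hq i).le _) hj
      · rw [Finsupp.notMem_support_iff.mp hj]
        simpa using Finset.sum_nonneg fun i _ => nsmul_nonneg (hq i).le (m' i)
    obtain ⟨m₀, ⟨hm₀w, hm₀φ⟩, hmin⟩ := Set.exists_min_image W
      (fun m' => ‖φ (Ideal.Quotient.mk J (monomial m' (1 : K)))‖) hW ⟨m, rfl, hφm⟩
    by_cases hirr : ∀ j, m₀ j < a j
    · exact hm₀φ (hφS (Submodule.subset_span ⟨⟨m₀, hirr⟩, rfl⟩))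
    · push Not at hirr
      obtain ⟨j, hj⟩ := hirr
      obtain ⟨m₁, rfl⟩ : ∃ m₁, m₀ = m₁ + Finsupp.single j (a j) :=
        ⟨m₀ - Finsupp.single j (a j), (tsub_add_cancel_of_le (by simpa using hj)).symm⟩
      rw [step, map_smul, smul_eq_mul] at hm₀φ
      have h := hmin (m₁ + r j) ⟨by
        rw [← hm₀w, map_add, map_add, hqr, Finsupp.weight_single, nsmul_eq_mul],
        right_ne_zero_of_mul hm₀φ⟩
      simp only [step, map_smul, smul_eq_mul, norm_mul] at h
      have h0 := norm_pos_iff.mpr (right_ne_zero_of_mul hm₀φ)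
      nlinarith [hc j]
  rw [eq_top_iff]
  rintro x -
  obtain ⟨p, rfl⟩ := Ideal.Quotient.mk_surjective x
  induction p using MvPolynomial.induction_on' with
  | monomial m b =>
    rw [← mul_one b, ← smul_eq_mul, ← smul_monomial]
    exact S.smul_mem b (key m)
  | add p q hp hq => rw [map_add]; exact S.add_mem hp hq

end BinomialReduction

namespace LoopPolynomial

variable {ι : Type*}

/-- Positive weights for which every `x_{σ i} x_i ^ a_i` has degree one. -/
theorem exists_weights [Fintype ι] (σ : ι → ι) (a : ι → ℕ) (ha : ∀ i, 2 ≤ a i) :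
    ∃ q : ι → ℝ, (∀ i, 0 < q i) ∧ ∀ i, a i * q i + q (σ i) = 1 := by
  have ha' (i : ι) : (2 : ℝ) ≤ a i := by exact_mod_cast ha i
  let f : (ι → ℝ) → ι → ℝ := fun q i => (1 - q (σ i)) / a i
  have hmaps : Set.MapsTo f (Set.Icc 0 1) (Set.Icc 0 1) := by
    intro q hq
    refine ⟨fun i => ?_, fun i => ?_⟩
    · exact div_nonneg (sub_nonneg.mpr (hq.2 (σ i))) (Nat.cast_nonneg _)
    · have h0 : 0 ≤ q (σ i) := hq.1 (σ i)
      exact (div_le_one (by linarith [ha' i])).mpr (by linarith [ha' i])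
  have hlip : LipschitzWith (1 / 2) f := by
    refine LipschitzWith.of_dist_le_mul fun p q => ?_
    refine (dist_pi_le_iff (by positivity)).mpr fun i => ?_
    have h := dist_le_pi_dist p q (σ i)
    have hfi : f p i - f q i = -(p (σ i) - q (σ i)) / a i := by simp only [f]; ring
    rw [Real.dist_eq] at h ⊢
    rw [hfi, abs_div, abs_neg, Nat.abs_cast, div_le_iff₀ (by linarith [ha' i])]
    have hd : 0 ≤ dist p q := dist_nonneg
    push_cast
    nlinarith [ha' i]
  have hcontr : ContractingWith (1 / 2) (hmaps.restrict f _ _) :=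
    ⟨by rw [← NNReal.coe_lt_coe]; norm_num, fun x y => hlip x y⟩
  obtain ⟨q, hq, hfix, -⟩ := hcontr.exists_fixedPoint' (x := 0) isClosed_Icc.isComplete hmaps
    ⟨le_rfl, zero_le_one⟩ (edist_ne_top _ _)
  have heq (i : ι) : a i * q i + q (σ i) = 1 := by
    have h : (1 - q (σ i)) / a i = q i := congrFun hfix i
    have h2 : (a i : ℝ) ≠ 0 := by linarith [ha' i]
    rw [div_eq_iff h2] at h
    linarith
  refine ⟨q, fun i => (hq.1 i).lt_of_ne fun h0 => ?_, heq⟩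
  have h0' : q i = 0 := h0.symm
  have h1 := heq i
  have h2 := heq (σ i)
  have h3 : 0 ≤ q (σ (σ i)) := hq.1 _
  rw [h0', mul_zero, zero_add] at h1
  rw [h1] at h2
  linarith [ha' (σ i)]

variable [DecidableEq ι] {R : Type*} [CommRing R]

theorem pderiv_loop [Fintype ι] (σ : Equiv.Perm ι) (hσ : ∀ i, σ i ≠ i) (a : ι → ℕ) (j : ι) :
    pderiv (σ j) (∑ i, X (σ i) * X i ^ a i : MvPolynomial ι R) =
      monomial (Finsupp.single j (a j)) 1 -
        monomial (Finsupp.single (σ (σ j)) 1 + Finsupp.single (σ j) (a (σ j) - 1))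
          (-(a (σ j) : R)) := by
  have hterm (i : ι) : pderiv (σ j) (X (σ i) * X i ^ a i : MvPolynomial ι R) =
      (if i = j then X j ^ a j else 0) +
      (if i = σ j then (a (σ j) : MvPolynomial ι R) * X (σ (σ j)) * X (σ j) ^ (a (σ j) - 1)
        else 0) := by
    rw [pderiv_mul, pderiv_pow, pderiv_X, pderiv_X, Pi.single_apply, Pi.single_apply]
    by_cases h1 : i = j
    · subst h1
      simp [(hσ i).symm]
    · by_cases h2 : i = σ j
      · subst h2
        simp [hσ j]
        ring
      · simp [h1, h2]
  rw [map_sum, Finset.sum_congr rfl fun i _ => hterm i, Finset.sum_add_distrib]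
  simp only [Finset.sum_ite_eq', Finset.mem_univ, if_true]
  rw [map_neg, sub_neg_eq_add, X_pow_eq_monomial, X_pow_eq_monomial, X, mul_assoc, monomial_mul,
    one_mul, ← map_natCast (C : R →+* MvPolynomial ι R), C_mul_monomial, mul_one]

/-- The irreducible monomials form a basis of the Milnor ring of a loop polynomial. -/
theorem basis_irreducible [Fintype ι] (σ : Equiv.Perm ι) (hσ : ∀ i, σ i ≠ i) (a : ι → ℕ)
    (ha : ∀ i, 2 ≤ a i) (J : Ideal (MvPolynomial ι ℂ))
    (hJ : J = Ideal.span (Set.range fun i => pderiv i (∑ i, X (σ i) * X i ^ a i))) :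
    LinearIndependent ℂ (fun m : {m : ι →₀ ℕ // ∀ j, m j < a j} =>
        Ideal.Quotient.mk J (monomial (m : ι →₀ ℕ) 1)) ∧
      Submodule.span ℂ (Set.range (fun m : {m : ι →₀ ℕ // ∀ j, m j < a j} =>
        Ideal.Quotient.mk J (monomial (m : ι →₀ ℕ) 1))) = ⊤ := by
  rw [← σ.surjective.range_comp] at hJ
  simp only [Function.comp_def, pderiv_loop σ hσ] at hJ
  obtain ⟨q, hq, hqa⟩ := exists_weights σ a ha
  refine ⟨BinomialReduction.linearIndependent_irreducible a _ _ J hJ,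
    BinomialReduction.span_irreducible a _ _ J hJ (fun j => ?_) q hq fun j => ?_⟩
  · rw [norm_neg, Complex.norm_natCast]
    exact_mod_cast ha (σ j)
  · rw [map_add, Finsupp.weight_single, Finsupp.weight_single, one_smul, nsmul_eq_mul,
      Nat.cast_sub (by linarith [ha (σ j)])]
    push_cast
    linarith [hqa j, hqa (σ j)]

end LoopPolynomial

/-- The classes of the monomials `x^m` with `0 ≤ m_j ≤ a_j − 1`
for all `j` form a `ℂ`-basis of the Milnor ring of the dual loop polynomial
`w = x_n x_1^{a_1} + ∑_{i=2}^{n} x_{i−1} x_i^{a_i}`.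
Indices are `0`-based via `Fin n`. -/
theorem dual_loop_standard_basis {n : ℕ} (hn : 2 ≤ n) (a : ℕ → ℕ)
    (ha : ∀ i < n, 2 ≤ a i)
    (w : MvPolynomial (Fin n) ℂ)
    (hw : w = ∑ i : Fin n,
      if (i : ℕ) = 0 then
        X (⟨n - 1, Nat.sub_lt (by omega) one_pos⟩ : Fin n) * X i ^ a (i : ℕ)
      else X (⟨(i : ℕ) - 1, Nat.lt_of_le_of_lt (Nat.sub_le _ _) i.isLt⟩ : Fin n) *
        X i ^ a (i : ℕ))
    (J : Ideal (MvPolynomial (Fin n) ℂ))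
    (hJ : J = Ideal.span (Set.range fun i => MvPolynomial.pderiv i w))
    (B : Set (Fin n → ℕ))
    (hB : B = {m | ∀ j : Fin n, m j ≤ a (j : ℕ) - 1}) :
    LinearIndependent ℂ (fun m : B =>
        Ideal.Quotient.mk J (∏ j : Fin n, X j ^ (m : Fin n → ℕ) j)) ∧
      Submodule.span ℂ (Set.range (fun m : B =>
        Ideal.Quotient.mk J (∏ j : Fin n, X j ^ (m : Fin n → ℕ) j))) = ⊤ := by
  obtain ⟨k, rfl⟩ : ∃ k, n = k + 2 := ⟨n - 2, by omega⟩
  let σ : Equiv.Perm (Fin (k + 2)) := Equiv.subRight 1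
  have hσ (i : Fin (k + 2)) : σ i ≠ i := by simp [σ]
  have hw' : w = ∑ i, X (σ i) * X i ^ a (i : ℕ) := by
    rw [hw]
    refine Finset.sum_congr rfl fun i _ => ?_
    have hval : ((σ i : Fin (k + 2)) : ℕ) = if i = 0 then k + 1 else (i : ℕ) - 1 :=
      Fin.coe_sub_one i
    split_ifs with h
    · congr 2
      ext
      rw [hval, if_pos (Fin.ext h)]
      rfl
    · congr 2
      ext
      rw [hval, if_neg fun h' => h (congrArg Fin.val h')]
  obtain ⟨hli, hspan⟩ := LoopPolynomial.basis_irreducible σ hσ (fun i => a i)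
    (fun i => ha i i.isLt) J (by rw [hJ, hw'])
  let e : B ≃ {m : Fin (k + 2) →₀ ℕ // ∀ j, m j < a (j : ℕ)} :=
    Finsupp.equivFunOnFinite.symm.subtypeEquiv fun m => by
      rw [hB, Set.mem_ofPred_eq]
      refine forall_congr' fun j => ?_
      have := ha j j.isLt
      simp only [Finsupp.equivFunOnFinite_symm_apply_apply]
      omega
  have hfam : (fun m : B => Ideal.Quotient.mk J (∏ j, X j ^ (m : Fin (k + 2) → ℕ) j)) =
      (fun m : {m : Fin (k + 2) →₀ ℕ // ∀ j, m j < a (j : ℕ)} =>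
        Ideal.Quotient.mk J (monomial (m : Fin (k + 2) →₀ ℕ) 1)) ∘ e := by
    funext m
    simp only [Function.comp_apply]
    congr 1
    rw [monomial_eq, C_1, one_mul, Finsupp.prod_fintype _ _ fun _ => pow_zero _]
    rfl
  rw [hfam, e.surjective.range_comp]
  exact ⟨hli.comp e e.injective, hspan⟩
end
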